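/- arXiv:1510.02561 — 2 statements merged into one kernel-verified Lean document; each statement's English description precedes it below -/
import Mathlib

section
/- Let n ≥ 2 and F : (Fin n → ZMod 2) → ZMod 2. Suppose (i) F has degree at least two, in the precise sense that there exist indices i ≠ j in Fin n and some q : Fin n → ZMod 2 such that F(q[i↦0][j↦0]) + F(q[i↦0][j↦1]) + F(q[i↦1][j↦0]) + F(q[i↦1][j↦1]) = 1 in ZMod 2; and (ii) F is not of the form F q = q i + q j + G q for any indices i ≠ j and any G depending only on the coordinates outside {i, j}. Let ψ_F be the (n+1)-qubit balanced state: ψ_F s = 2^(−n/2) if s n equals F applied to the first n coordinates of s (identifying Fin 2 with ZMod 2) and 0 otherwise. Then, in the measurement scenario in which each of the n+1 parties may choose between the Pauli observables Y and Z, the empirical model of ψ_F is logically contextual. -/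
open Complex Finset

/-- A local observable: a pair of vectors forming an orthonormal basis of ℂ². -/
structure Obs where
  eplus : Fin 2 → ℂ
  eminus : Fin 2 → ℂ
  norm_plus : ∑ a : Fin 2, ‖eplus a‖ ^ 2 = 1
  norm_minus : ∑ a : Fin 2, ‖eminus a‖ ^ 2 = 1
  orth : ∑ a : Fin 2, (starRingEnd ℂ) (eplus a) * eminus a = 0

/-- Probability that context `c` yields joint outcome `o` on state `ψ`. -/
noncomputable def jointProb {n : ℕ} (ψ : (Fin n → Fin 2) → ℂ) (c : Fin n → Obs)
    (o : Fin n → Bool) : ℝ :=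
  ‖∑ s : Fin n → Fin 2,
      (∏ i : Fin n,
        (starRingEnd ℂ) ((if o i then (c i).eplus else (c i).eminus) (s i))) * ψ s‖ ^ 2

/-- A global assignment `g` is consistent if in every context of the scenario `M`
the induced joint outcome is possible. -/
def Consistent {n : ℕ} (ψ : (Fin n → Fin 2) → ℂ) (M : Fin n → Set Obs)
    (g : Fin n → Obs → Bool) : Prop :=
  ∀ c : Fin n → Obs, (∀ i, c i ∈ M i) → jointProb ψ c (fun i => g i (c i)) ≠ 0

def StronglyContextual {n : ℕ} (ψ : (Fin n → Fin 2) → ℂ) (M : Fin n → Set Obs) : Prop :=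
  ¬ ∃ g : Fin n → Obs → Bool, Consistent ψ M g

def LogicallyContextual {n : ℕ} (ψ : (Fin n → Fin 2) → ℂ) (M : Fin n → Set Obs) : Prop :=
  ∃ c : Fin n → Obs, (∀ i, c i ∈ M i) ∧ ∃ o : Fin n → Bool,
    jointProb ψ c o ≠ 0 ∧
    ¬ ∃ g : Fin n → Obs → Bool, Consistent ψ M g ∧ ∀ i, g i (c i) = o i

/-- The Pauli Z observable. -/
noncomputable def pauliZ : Obs where
  eplus := ![1, 0]
  eminus := ![0, 1]
  norm_plus := by simp [Fin.sum_univ_two]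
  norm_minus := by simp [Fin.sum_univ_two]
  orth := by simp [Fin.sum_univ_two]

/-- The Pauli Y observable. -/
noncomputable def pauliY : Obs where
  eplus := ![((Real.sqrt 2)⁻¹ : ℝ), ((Real.sqrt 2)⁻¹ : ℝ) * Complex.I]
  eminus := ![((Real.sqrt 2)⁻¹ : ℝ), -(((Real.sqrt 2)⁻¹ : ℝ) * Complex.I)]
  norm_plus := by
    have h : ‖(((Real.sqrt 2)⁻¹ : ℝ) : ℂ)‖ ^ 2 = 1 / 2 := by
      rw [Complex.norm_real, Real.norm_eq_abs, _root_.sq_abs, inv_pow,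
        Real.sq_sqrt (by norm_num : (0:ℝ) ≤ 2)]
      norm_num
    simp [Fin.sum_univ_two, norm_mul, h]
    norm_num [h]
  norm_minus := by
    have h : ‖(((Real.sqrt 2)⁻¹ : ℝ) : ℂ)‖ ^ 2 = 1 / 2 := by
      rw [Complex.norm_real, Real.norm_eq_abs, _root_.sq_abs, inv_pow,
        Real.sq_sqrt (by norm_num : (0:ℝ) ≤ 2)]
      norm_num
    simp [Fin.sum_univ_two, norm_mul, h]
    norm_num [h]
  orth := by
    have h : ((starRingEnd ℂ) (((Real.sqrt 2)⁻¹ : ℝ) : ℂ)) = (((Real.sqrt 2)⁻¹ : ℝ) : ℂ) :=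
      Complex.conj_ofReal _
    simp [Fin.sum_univ_two, map_mul, Complex.conj_I, h]
    linear_combination (((Real.sqrt 2 : ℝ) : ℂ))⁻¹ * (((Real.sqrt 2 : ℝ) : ℂ))⁻¹ * Complex.I_mul_I

/-- The Pauli X observable. -/
noncomputable def pauliX : Obs where
  eplus := ![((Real.sqrt 2)⁻¹ : ℝ), ((Real.sqrt 2)⁻¹ : ℝ)]
  eminus := ![((Real.sqrt 2)⁻¹ : ℝ), -(((Real.sqrt 2)⁻¹ : ℝ) : ℂ)]
  norm_plus := by
    have h : ‖(((Real.sqrt 2)⁻¹ : ℝ) : ℂ)‖ ^ 2 = 1 / 2 := by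
      rw [Complex.norm_real, Real.norm_eq_abs, _root_.sq_abs, inv_pow,
        Real.sq_sqrt (by norm_num : (0:ℝ) ≤ 2)]
      norm_num
    simp [Fin.sum_univ_two, h]
    norm_num [h]
  norm_minus := by
    have h : ‖(((Real.sqrt 2)⁻¹ : ℝ) : ℂ)‖ ^ 2 = 1 / 2 := by
      rw [Complex.norm_real, Real.norm_eq_abs, _root_.sq_abs, inv_pow,
        Real.sq_sqrt (by norm_num : (0:ℝ) ≤ 2)]
      norm_num
    simp [Fin.sum_univ_two, h]
    norm_num [h]
  orth := by
    have h : ((starRingEnd ℂ) (((Real.sqrt 2)⁻¹ : ℝ) : ℂ)) = (((Real.sqrt 2)⁻¹ : ℝ) : ℂ) :=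
      Complex.conj_ofReal _
    simp [Fin.sum_univ_two, h]

/-- Amplitude factor of a local outcome. -/
noncomputable def fac (ob : Obs) (o : Bool) (x : Fin 2) : ℂ :=
  (starRingEnd ℂ) ((if o then ob.eplus else ob.eminus) x)

lemma fac_Z (o : Bool) (x : Fin 2) : fac pauliZ o x ≠ 0 ↔ o = decide (x = 0) := by
  cases o <;> fin_cases x <;> simp [fac, pauliZ]

lemma fac_Y (o : Bool) (x : Fin 2) : fac pauliY o x ≠ 0 := by
  cases o <;> fin_cases x <;> simp [fac, pauliY]

/-- Ratio of the two amplitudes of a Y outcome. -/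
noncomputable def rr (o : Bool) (x : Fin 2) : ℂ := if o = decide (x = 0) then -I else I

lemma fac_Y_flip (o : Bool) (x : Fin 2) : fac pauliY o (x + 1) = rr o x * fac pauliY o x := by
  cases o <;> fin_cases x <;> simp [fac, pauliY, rr]
  all_goals
    first | ring1 | linear_combination ((Real.sqrt 2 : ℝ) : ℂ)⁻¹ * Complex.I_mul_I

lemma rr_mul (o o' : Bool) (x x' y y' : Fin 2) (hx : x + x' = y + y')
    (h : (o = decide (y = 0)) ↔ (o' = decide (y' = 0))) : rr o x * rr o' x' = -1 := by
  have h2 : (o = decide (x = 0)) ↔ (o' = decide (x' = 0)) := by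
    revert o o' x x' y y'; decide
  unfold rr
  by_cases h3 : o = decide (x = 0)
  · rw [if_pos h3, if_pos (h2.1 h3)]; simp
  · rw [if_neg h3, if_neg (fun h4 => h3 (h2.2 h4))]; simp

/-- The balanced state. -/
noncomputable def psi {n : ℕ} (F : (Fin n → Fin 2) → Fin 2) (s : Fin (n + 1) → Fin 2) : ℂ :=
  if s (Fin.last n) = F (fun k => s k.castSucc)
  then ((((Real.sqrt 2) ^ n)⁻¹ : ℝ) : ℂ) else 0

lemma psi_ne {n : ℕ} (F : (Fin n → Fin 2) → Fin 2) (s : Fin (n + 1) → Fin 2) :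
    psi F s ≠ 0 ↔ s (Fin.last n) = F (fun k => s k.castSucc) := by
  unfold psi
  split_ifs with h <;> simp [h]

lemma jp_eq {n : ℕ} (ψ : (Fin n → Fin 2) → ℂ) (c : Fin n → Obs) (o : Fin n → Bool) :
    jointProb ψ c o = ‖∑ s : Fin n → Fin 2, (∏ m, fac (c m) (o m) (s m)) * ψ s‖ ^ 2 := rfl

lemma exists_of_jp {n : ℕ} (ψ : (Fin n → Fin 2) → ℂ) (c : Fin n → Obs) (o : Fin n → Bool)
    (h : jointProb ψ c o ≠ 0) : ∃ s, ψ s ≠ 0 ∧ ∀ m, fac (c m) (o m) (s m) ≠ 0 := by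
  by_contra hc
  push Not at hc
  apply h
  rw [jp_eq, Finset.sum_eq_zero]
  · simp
  · intro s _
    by_cases hs : ψ s = 0
    · simp [hs]
    · obtain ⟨m, hm⟩ := hc s hs
      rw [Finset.prod_eq_zero (mem_univ m) hm, zero_mul]

lemma jp_single {n : ℕ} (ψ : (Fin n → Fin 2) → ℂ) (c : Fin n → Obs) (o : Fin n → Bool)
    (s0 : Fin n → Fin 2) (h0 : ψ s0 ≠ 0) (h1 : ∀ m, fac (c m) (o m) (s0 m) ≠ 0)
    (h : ∀ s, ψ s ≠ 0 → (∀ m, fac (c m) (o m) (s m) ≠ 0) → s = s0) :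
    jointProb ψ c o ≠ 0 := by
  rw [jp_eq, Finset.sum_eq_single s0]
  · have := Finset.prod_ne_zero_iff.2 (fun m (_ : m ∈ univ) => h1 m)
    exact pow_ne_zero _ (norm_ne_zero_iff.2 (mul_ne_zero this h0))
  · intro s _ hs
    by_contra hne
    have h2 := mul_ne_zero_iff.1 hne
    exact hs (h s h2.2 (fun m => Finset.prod_ne_zero_iff.1 h2.1 m (mem_univ m)))
  · simp

/-- Flip the coordinate `k` and the last coordinate. -/
def flipTwo {n : ℕ} (k : Fin n) (s : Fin (n + 1) → Fin 2) : Fin (n + 1) → Fin 2 :=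
  fun m => if m = k.castSucc ∨ m = Fin.last n then s m + 1 else s m

lemma fin2_add (x : Fin 2) : x + 1 + 1 = x := by revert x; decide

lemma fin2_ne (x y : Fin 2) : x ≠ y ↔ x = y + 1 := by revert x y; decide

lemma jp_flip {n : ℕ} (F : (Fin n → Fin 2) → Fin 2) (p : Fin n → Fin 2) (k : Fin n)
    (hd : ∀ r, (∀ m, m ≠ k → r m = p m) → r k ≠ p k → F r ≠ F p)
    (o : Fin (n + 1) → Bool)
    (ho : ∀ m : Fin n, m ≠ k → o m.castSucc = decide (p m = 0))
    (hw : (o k.castSucc = decide (p k = 0)) ↔ (o (Fin.last n) = decide (F p = 0))) :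
    jointProb (psi F)
      (fun m => if m = k.castSucc ∨ m = Fin.last n then pauliY else pauliZ) o = 0 := by
  rw [jp_eq]
  suffices h : ∑ s : Fin (n + 1) → Fin 2, (∏ m, fac
      (if m = k.castSucc ∨ m = Fin.last n then pauliY else pauliZ) (o m) (s m)) * psi F s = 0 by
    rw [h]; simp
  have hkl : k.castSucc ≠ Fin.last n := (Fin.castSucc_lt_last k).ne
  refine Finset.sum_involution (fun s _ => flipTwo k s) ?_ ?_ (fun _ _ => mem_univ _) ?_
  · intro s _
    have hprod : (∏ m, fac (if m = k.castSucc ∨ m = Fin.last n then pauliY else pauliZ) (o m)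
          (flipTwo k s m)) =
        (rr (o k.castSucc) (s k.castSucc) * rr (o (Fin.last n)) (s (Fin.last n))) *
        ∏ m, fac (if m = k.castSucc ∨ m = Fin.last n then pauliY else pauliZ) (o m) (s m) := by
      have h1 : ∀ m, fac (if m = k.castSucc ∨ m = Fin.last n then pauliY else pauliZ) (o m)
          (flipTwo k s m) =
          (if m = k.castSucc ∨ m = Fin.last n then rr (o m) (s m) else 1) *
          fac (if m = k.castSucc ∨ m = Fin.last n then pauliY else pauliZ) (o m) (s m) := by
        intro m
        unfold flipTwo
        split_ifs
        · exact fac_Y_flip _ _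
        · simp
      rw [Finset.prod_congr rfl (fun m _ => h1 m), Finset.prod_mul_distrib]
      congr 1
      rw [Fintype.prod_eq_mul k.castSucc (Fin.last n) hkl]
      · simp
      · rintro m ⟨ha, hb⟩
        simp [ha, hb]
    rw [hprod]
    by_cases hz : ∀ m : Fin n, m ≠ k → s m.castSucc = p m
    · -- the matching case
      have hF : ∀ r : Fin n → Fin 2, (∀ m, m ≠ k → r m = p m) → F r + r k = F p + p k := by
        intro r hr
        by_cases hrk : r k = p k
        · have : r = p := by
            funext m
            by_cases hm : m = k
            · rw [hm, hrk]
            · exact hr m hm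
          rw [this]
        · have h1 := hd r hr hrk
          replace hrk := (fin2_ne _ _).1 hrk
          rw [fin2_ne] at h1
          rw [h1, hrk]
          generalize F p = a
          generalize p k = b
          revert a b; decide
      have hs := hF (fun m => s m.castSucc) hz
      have hs' := hF (fun m => flipTwo k s m.castSucc) (by
        intro m hm
        simp [flipTwo, hm, hz m hm, (Fin.castSucc_lt_last m).ne])
      have hk' : flipTwo k s k.castSucc = s k.castSucc + 1 := by simp [flipTwo]
      have hl' : flipTwo k s (Fin.last n) = s (Fin.last n) + 1 := by simp [flipTwo]
      simp only [hk'] at hs'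
      have hpsi : psi F (flipTwo k s) = psi F s := by
        unfold psi
        rw [hl']
        congr 1
        revert hs hs'
        generalize F (fun m => flipTwo k s m.castSucc) = a
        generalize F (fun m => s m.castSucc) = b
        generalize s (Fin.last n) = c
        generalize s k.castSucc = d
        generalize F p = e
        generalize p k = f
        intro h1 h2
        rw [eq_iff_iff]
        revert a b c d e f; decide
      rw [hpsi]
      by_cases h0 : psi F s = 0
      · simp [h0]
      · have h0' := (psi_ne F s).1 h0
        rw [rr_mul _ _ _ _ (p k) (F p) (by rw [h0', add_comm, hs, add_comm]) hw]
        ring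
    · push Not at hz
      obtain ⟨m, hm, hne⟩ := hz
      rw [Finset.prod_eq_zero (mem_univ m.castSucc)]
      · simp
      · by_contra hc
        simp only [Fin.castSucc_inj, hm, (Fin.castSucc_lt_last m).ne, or_self, if_false] at hc
        have h2 := (fac_Z _ _).1 hc
        rw [ho m hm] at h2
        apply hne
        revert h2
        generalize p m = a
        generalize s m.castSucc = b
        revert a b; decide
  · intro s _ _ h
    have := congrFun h (Fin.last n)
    simp [flipTwo] at this
  · intro s _
    funext m
    simp only [flipTwo]
    split_ifs
    · exact fin2_add _
    · rfl

lemma minority (f : Fin 2 → Fin 2 → Fin 2) (h : f 0 0 + f 0 1 + f 1 0 + f 1 1 = 1) :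
    ∃ a b, ∀ x y, f x y = f a b → x = a ∧ y = b := by
  revert f; decide

lemma dec_inj (a b : Fin 2) (h : decide (a = 0) = decide (b = 0)) : a = b := by
  revert a b; decide

lemma main_aux {n : ℕ} (F : (Fin n → Fin 2) → Fin 2) (p : Fin n → Fin 2) (i j : Fin n)
    (hij : i ≠ j) (H : ∀ r, (∀ k, k ≠ i → k ≠ j → r k = p k) → F r = F p → r = p) :
    LogicallyContextual (psi F) (fun _ => ({pauliY, pauliZ} : Set Obs)) := by
  have hil : ∀ k : Fin n, Fin.last n ≠ k.castSucc := fun k => (Fin.castSucc_lt_last k).ne'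
  let c : Fin (n + 1) → Obs :=
    fun m => if m = i.castSucc ∨ m = j.castSucc then pauliY else pauliZ
  let s0 : Fin (n + 1) → Fin 2 := Fin.snoc (α := fun _ => Fin 2) p (F p)
  let o : Fin (n + 1) → Bool :=
    fun m => if m = j.castSucc then !decide (s0 m = 0) else decide (s0 m = 0)
  have hs0 : ∀ k : Fin n, s0 k.castSucc = p k := fun k => by simp [s0]
  have hs0l : s0 (Fin.last n) = F p := by simp [s0]
  -- outcomes agreeing with `s0` off `i`, `j` and on the graph of `F` equal `s0`
  have key : ∀ s, psi F s ≠ 0 → (∀ m, m ≠ i.castSucc → m ≠ j.castSucc → s m = s0 m) →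
      s = s0 := by
    intro s hs hm
    rw [psi_ne] at hs
    have hl := hm (Fin.last n) (hil i) (hil j)
    have hr := H (fun k => s k.castSucc) (by
      intro k hk hk'
      rw [← hs0 k]
      exact hm _ (by simpa using hk) (by simpa using hk')) (by rw [← hs, hl, hs0l])
    funext m
    refine Fin.lastCases hl (fun k => ?_) m
    rw [hs0]
    exact congrFun hr k
  refine ⟨c, ?_, o, ?_, ?_⟩
  · intro m
    simp only [c]
    split_ifs <;> simp
  · apply jp_single _ _ _ s0
    · rw [psi_ne, hs0l]
      simp only [hs0]
    · intro m
      simp only [c]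
      split_ifs with h
      · exact fac_Y _ _
      · push Not at h
        rw [fac_Z]
        simp [o, h.2]
    · intro s hs hf
      apply key s hs
      intro m h1 h2
      have h3 := hf m
      simp only [c, h1, h2, or_self, if_false] at h3
      rw [fac_Z] at h3
      simp only [o, h2, if_false] at h3
      exact (dec_inj _ _ h3).symm
  · rintro ⟨g, hg, hgo⟩
    -- all-Z context
    obtain ⟨z, hz, hzf⟩ := exists_of_jp _ _ _ (hg (fun _ => pauliZ) (by simp))
    have hzo : ∀ m, g m pauliZ = decide (z m = 0) := fun m => (fac_Z _ _).1 (hzf m)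
    have hzs : z = s0 := by
      apply key z hz
      intro m h1 h2
      have h3 := hgo m
      simp only [c, h1, h2, or_self, if_false, o, hzo] at h3
      exact dec_inj _ _ h3
    subst hzs
    have hY : ∀ k : Fin n,
        (∀ r, (∀ m, m ≠ k → r m = p m) → r k ≠ p k → F r ≠ F p) →
        ¬ ((g k.castSucc pauliY = decide (p k = 0)) ↔
          (g (Fin.last n) pauliY = decide (F p = 0))) := by
      intro k hd hw
      refine hg (fun m => if m = k.castSucc ∨ m = Fin.last n then pauliY else pauliZ) ?_ ?_
      · intro m
        dsimp only
        split_ifs <;> simp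
      · apply jp_flip F p k hd
        · intro m hm
          simp only [Fin.castSucc_inj, hm, (hil m).symm, or_self, if_false]
          rw [hzo, hs0]
        · simpa using hw
    have h1 := hY i (fun r hr hne hF => hne (by
      rw [H r (fun k hk _ => hr k hk) hF]))
    have h2 := hY j (fun r hr hne hF => hne (by
      rw [H r (fun k _ hk => hr k hk) hF]))
    have h3 := hgo i.castSucc
    have h4 := hgo j.castSucc
    simp only [c, o, Fin.castSucc_inj, hij, hs0, true_or, or_true, if_true, if_false] at h3 h4
    rw [h3] at h1
    rw [h4] at h2
    simp at h1 h2
    exact h1 h2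

lemma main_two {n : ℕ} (F : (Fin n → Fin 2) → Fin 2)
    (hdeg : ∃ i j : Fin n, i ≠ j ∧ ∃ q : Fin n → Fin 2,
      F (Function.update (Function.update q i 0) j 0)
        + F (Function.update (Function.update q i 0) j 1)
        + F (Function.update (Function.update q i 1) j 0)
        + F (Function.update (Function.update q i 1) j 1) = 1) :
    LogicallyContextual (psi F) (fun _ => ({pauliY, pauliZ} : Set Obs)) := by
  obtain ⟨i, j, hij, q, hq⟩ := hdeg
  obtain ⟨a, b, hab⟩ := minority
    (fun x y => F (Function.update (Function.update q i x) j y)) hq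
  refine main_aux F (Function.update (Function.update q i a) j b) i j hij ?_
  intro r hr hF
  have hrr : r = Function.update (Function.update q i (r i)) j (r j) := by
    funext k
    by_cases hkj : k = j
    · subst hkj; simp
    · by_cases hki : k = i
      · subst hki; simp [hkj]
      · have := hr k hki hkj
        simpa [hkj, hki] using this
  have h := hab (r i) (r j) (by
    rw [← hrr]
    exact hF)
  rw [hrr, h.1, h.2]

lemma psi_eq {n : ℕ} (F : (Fin n → ZMod 2) → ZMod 2) :
    (fun s : Fin (n + 1) → Fin 2 =>
        if ((s (Fin.last n) : ℕ) : ZMod 2) =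
            F (fun k : Fin n => ((s k.castSucc : ℕ) : ZMod 2))
        then ((((Real.sqrt 2) ^ n)⁻¹ : ℝ) : ℂ) else 0) = psi (n := n) F := by
  let e : Fin 2 → ZMod 2 := fun x => x
  have hcast : ∀ x : Fin 2, ((x : ℕ) : ZMod 2) = e x := by
    intro x
    fin_cases x <;> rfl
  funext s
  simp only [hcast]
  by_cases h : e (s (Fin.last n)) = F (fun k => e (s k.castSucc))
  · rw [if_pos h]
    exact (if_pos (show s (Fin.last n) = (F : (Fin n → Fin 2) → Fin 2) _ from h)).symm
  · rw [if_neg h]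
    exact (if_neg (c := s (Fin.last n) = (id F : (Fin n → Fin 2) → Fin 2) _) h).symm

/-- Any balanced `(n+1)`-qubit state whose functional dependency `F` has degree at least
two and is not of the form `q i + q j + G` is logically contextual for the scenario where
each party chooses between Pauli Y and Z. -/
theorem balanced_degTwo_logicallyContextual (n : ℕ) (hn : 2 ≤ n)
    (F : (Fin n → ZMod 2) → ZMod 2)
    (hdeg : ∃ i j : Fin n, i ≠ j ∧ ∃ q : Fin n → ZMod 2,
      F (Function.update (Function.update q i 0) j 0)
        + F (Function.update (Function.update q i 0) j 1)
        + F (Function.update (Function.update q i 1) j 0)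
        + F (Function.update (Function.update q i 1) j 1) = 1)
    (hnot : ¬ ∃ i j : Fin n, i ≠ j ∧ ∃ G : (Fin n → ZMod 2) → ZMod 2,
      (∀ q q' : Fin n → ZMod 2, (∀ k, k ≠ i → k ≠ j → q k = q' k) → G q = G q') ∧
      ∀ q, F q = q i + q j + G q) :
    LogicallyContextual
      (fun s : Fin (n + 1) → Fin 2 =>
        if ((s (Fin.last n) : ℕ) : ZMod 2) =
            F (fun k : Fin n => ((s k.castSucc : ℕ) : ZMod 2))
        then ((((Real.sqrt 2) ^ n)⁻¹ : ℝ) : ℂ) else 0)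
      (fun _ : Fin (n + 1) => ({pauliY, pauliZ} : Set Obs)) := by
  rw [psi_eq]
  exact main_two (n := n) F hdeg
end

section
/- (The 21 Lemma.) Let ψ and φ be n-qubit states (unit vectors in (Fin n → Fin 2) → ℂ), each of product form 𝒫ₙ, and for a ∈ [0,1] set τ a := a•ψ + √(1−a²)•φ. If there exist 21 pairwise distinct values a ∈ [0,1] for which τ a is of product form 𝒫ₙ, then for every a ∈ [0,1] with τ a ≠ 0, the vector τ a is of product form 𝒫ₙ. -/
open Finset

/-- A nonzero maximally entangled 2-qubit vector: the one-sided contractions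
`∑ b, Φ (a, b) * conj (Φ (a', b))` equal a constant `c` when `a = a'` and `0` otherwise. -/
def MaxEnt (Φ : Fin 2 × Fin 2 → ℂ) : Prop :=
  Φ ≠ 0 ∧ ∃ c : ℂ, ∀ a a' : Fin 2,
    (∑ b : Fin 2, Φ (a, b) * (starRingEnd ℂ) (Φ (a', b))) = if a = a' then c else 0

/-- A nonzero vector `ψ : (Fin n → Fin 2) → ℂ` is of product form `𝒫ₙ` if, for some
partition of `Fin n` into blocks of size 1 or 2 (encoded by an involution `f`, whose
fixed points are the singleton blocks and whose 2-cycles `{i, f i}` are the pairs),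
`ψ` factors as a product of nonzero 1-qubit vectors `φ i` on the singleton blocks and
nonzero maximally entangled 2-qubit vectors `Φ i` on the pairs. -/
def ProductForm {n : ℕ} (ψ : (Fin n → Fin 2) → ℂ) : Prop :=
  ψ ≠ 0 ∧ ∃ f : Fin n → Fin n, (∀ i, f (f i) = i) ∧
    ∃ (φ : Fin n → (Fin 2 → ℂ)) (Φ : Fin n → (Fin 2 × Fin 2 → ℂ)),
      (∀ i, f i = i → φ i ≠ 0) ∧
      (∀ i, i < f i → MaxEnt (Φ i)) ∧
      ∀ s : Fin n → Fin 2,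
        ψ s = (∏ i ∈ Finset.univ.filter (fun i => f i = i), φ i (s i)) *
              (∏ i ∈ Finset.univ.filter (fun i => i < f i), Φ i (s i, s (f i)))


/-- Product form on the qubits in `S`, with matching `f`, up to a scalar. -/
def PFf {n : ℕ} (f : Fin n → Fin n) (S : Finset (Fin n)) (v : (Fin n → Fin 2) → ℂ) : Prop :=
  v ≠ 0 ∧ (∀ i, f (f i) = i) ∧ (∀ i ∈ S, f i ∈ S) ∧
    ∃ (c : ℂ) (φ : Fin n → (Fin 2 → ℂ)) (Φ : Fin n → (Fin 2 × Fin 2 → ℂ)),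
      (∀ i ∈ S, f i = i → φ i ≠ 0) ∧
      (∀ i ∈ S, i < f i → MaxEnt (Φ i)) ∧
      ∀ s : Fin n → Fin 2,
        v s = c * ((∏ i ∈ S with f i = i, φ i (s i)) *
              (∏ i ∈ S with i < f i, Φ i (s i, s (f i))))

def PF {n : ℕ} (S : Finset (Fin n)) (v : (Fin n → Fin 2) → ℂ) : Prop := ∃ f, PFf f S v

theorem PF_of_productForm {n : ℕ} {v : (Fin n → Fin 2) → ℂ} (h : ProductForm v) :
    PF univ v := by
  obtain ⟨h0, f, hf, φ, Φ, h1, h2, h3⟩ := h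
  exact ⟨f, h0, hf, by simp, 1, φ, Φ, fun i _ => h1 i, fun i _ => h2 i, by simpa using h3⟩

theorem MaxEnt.smul {Φ : Fin 2 × Fin 2 → ℂ} (h : MaxEnt Φ) {c : ℂ} (hc : c ≠ 0) :
    MaxEnt (fun x => c * Φ x) := by
  obtain ⟨h0, d, hd⟩ := h
  refine ⟨?_, c * (starRingEnd ℂ) c * d, ?_⟩
  · obtain ⟨x, hx⟩ := Function.ne_iff.1 h0
    exact Function.ne_iff.2 ⟨x, mul_ne_zero hc hx⟩
  · intro a a'
    have := hd a a'
    simp only [Fin.sum_univ_two, map_mul] at this ⊢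
    split_ifs at this ⊢ with h
    · rw [← this]; ring
    · linear_combination c * (starRingEnd ℂ) c * this

theorem productForm_of_PF {n : ℕ} (hn : 0 < n) {v : (Fin n → Fin 2) → ℂ} (h : PF univ v) :
    ProductForm v := by
  obtain ⟨f, h0, hf, -, c, φ, Φ, h1, h2, h3⟩ := h
  have hc : c ≠ 0 := by
    rintro rfl
    exact h0 (funext fun s => by simp [h3])
  have : NeZero n := ⟨hn.ne'⟩
  let d : Fin n → ℂ := fun i => if i = 0 then c else 1
  have hd : ∀ i, d i ≠ 0 := fun i => by
    dsimp [d]; split_ifs <;> simp [hc]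
  refine ⟨h0, f, hf, fun i x => d i * φ i x, fun i x => d i * Φ i x, ?_, ?_, ?_⟩
  · intro i hi
    obtain ⟨x, hx⟩ := Function.ne_iff.1 (h1 i (mem_univ _) hi)
    exact Function.ne_iff.2 ⟨x, mul_ne_zero (hd i) hx⟩
  · intro i hi
    exact (h2 i (mem_univ _) hi).smul (hd i)
  · intro s
    rw [h3, prod_mul_distrib, prod_mul_distrib]
    have : (∏ i with f i = i, d i) * (∏ i with i < f i, d i) = c := by
      simp only [d, prod_ite_eq', mem_filter, mem_univ, true_and]
      rcases (Fin.zero_le (f 0)).eq_or_lt with h | h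
      · simp [← h]
      · simp [h, h.ne']
    rw [← this]; ring

theorem PFf.dep {n : ℕ} {f : Fin n → Fin n} {S : Finset (Fin n)} {v : (Fin n → Fin 2) → ℂ}
    (h : PFf f S v) : DependsOn v (S : Set (Fin n)) := by
  obtain ⟨-, hf, hS, c, φ, Φ, -, -, h3⟩ := h
  intro x y hxy
  rw [h3, h3]
  congr 2
  · refine prod_congr rfl fun i hi => ?_
    rw [hxy i (mem_filter.1 hi).1]
  · refine prod_congr rfl fun i hi => ?_
    rw [hxy i (mem_filter.1 hi).1, hxy _ (hS i (mem_filter.1 hi).1)]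

theorem PF.dep {n : ℕ} {S : Finset (Fin n)} {v : (Fin n → Fin 2) → ℂ}
    (h : PF S v) : DependsOn v (S : Set (Fin n)) := h.elim fun _ h => h.dep

theorem PF.ne {n : ℕ} {S : Finset (Fin n)} {v : (Fin n → Fin 2) → ℂ}
    (h : PF S v) : v ≠ 0 := h.elim fun _ h => h.1

theorem PF.smul {n : ℕ} {S : Finset (Fin n)} {v : (Fin n → Fin 2) → ℂ}
    (h : PF S v) {c : ℂ} (hc : c ≠ 0) : PF S (fun s => c * v s) := by
  obtain ⟨f, h0, hf, hS, d, φ, Φ, h1, h2, h3⟩ := h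
  refine ⟨f, ?_, hf, hS, c * d, φ, Φ, h1, h2, fun s => by simp only [h3]; ring⟩
  obtain ⟨x, hx⟩ := Function.ne_iff.1 h0
  exact Function.ne_iff.2 ⟨x, mul_ne_zero hc hx⟩

/-- Mixed-ness conditions of a two-qubit vector. -/
theorem maxEnt_iff {Φ : Fin 2 × Fin 2 → ℂ} : MaxEnt Φ ↔ Φ ≠ 0 ∧
    (∑ b : Fin 2, Φ (0, b) * (starRingEnd ℂ) (Φ (1, b))) = 0 ∧
    (∑ b : Fin 2, Φ (0, b) * (starRingEnd ℂ) (Φ (0, b))) =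
      (∑ b : Fin 2, Φ (1, b) * (starRingEnd ℂ) (Φ (1, b))) := by
  constructor
  · rintro ⟨h0, c, hc⟩
    refine ⟨h0, by simpa using hc 0 1, ?_⟩
    rw [hc, hc]; simp
  · rintro ⟨h0, h1, h2⟩
    refine ⟨h0, (∑ b : Fin 2, Φ (0, b) * (starRingEnd ℂ) (Φ (0, b))), fun a a' => ?_⟩
    fin_cases a <;> fin_cases a'
    · simp
    · simpa using h1
    · have := congrArg (starRingEnd ℂ) h1
      simp only [Fin.sum_univ_two, map_add, map_mul, Complex.conj_conj, map_zero] at this ⊢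
      simp
      linear_combination this
    · simpa using h2.symm

theorem MaxEnt.det {Φ : Fin 2 × Fin 2 → ℂ} (h : MaxEnt Φ) :
    Φ (0, 0) * Φ (1, 1) - Φ (0, 1) * Φ (1, 0) ≠ 0 := by
  intro hd
  obtain ⟨h0, h1, h2⟩ := maxEnt_iff.1 h
  simp only [Fin.sum_univ_two] at h1 h2
  -- the squared norm of the first row, times entries, vanish
  have key : (Φ (0, 0) * (starRingEnd ℂ) (Φ (0, 0)) + Φ (0, 1) * (starRingEnd ℂ) (Φ (0, 1))) = 0 := by
    have hd' := congrArg (starRingEnd ℂ) hd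
    simp only [map_sub, map_mul, map_zero] at hd'
    have : (Φ (0, 0) * (starRingEnd ℂ) (Φ (0, 0)) + Φ (0, 1) * (starRingEnd ℂ) (Φ (0, 1))) ^ 2 = 0 := by
      have h1' := congrArg (starRingEnd ℂ) h1
      simp only [map_add, map_mul, map_zero, Complex.conj_conj] at h1'
      linear_combination (Φ (0, 0) * (starRingEnd ℂ) (Φ (0, 0)) +
          Φ (0, 1) * (starRingEnd ℂ) (Φ (0, 1))) * h2 +
        ((starRingEnd ℂ) (Φ (0, 0)) * (starRingEnd ℂ) (Φ (1, 1)) - (starRingEnd ℂ) (Φ (0, 1)) * (starRingEnd ℂ) (Φ (1, 0))) * hd +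
        (Φ (1, 0) * (starRingEnd ℂ) (Φ (0, 0)) + Φ (1, 1) * (starRingEnd ℂ) (Φ (0, 1))) * h1
    exact pow_eq_zero_iff (two_ne_zero) |>.1 this
  have key2 := h2 ▸ key
  rw [Complex.mul_conj, Complex.mul_conj, ← Complex.ofReal_add, Complex.ofReal_eq_zero] at key key2
  have e1 := (add_eq_zero_iff_of_nonneg (Complex.normSq_nonneg _) (Complex.normSq_nonneg _)).1 key
  have e2 := (add_eq_zero_iff_of_nonneg (Complex.normSq_nonneg _) (Complex.normSq_nonneg _)).1 key2
  simp only [Complex.normSq_eq_zero] at e1 e2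
  apply h0
  funext ⟨x, y⟩
  fin_cases x <;> fin_cases y <;> simp [e1, e2]

open ComplexOrder in
theorem MaxEnt.swap {Φ : Fin 2 × Fin 2 → ℂ} (h : MaxEnt Φ) : MaxEnt (fun x => Φ (x.2, x.1)) := by
  obtain ⟨h0, c, hc⟩ := h
  let M : Matrix (Fin 2) (Fin 2) ℂ := Matrix.of fun a b => Φ (a, b)
  have hM : M * M.conjTranspose = c • (1 : Matrix (Fin 2) (Fin 2) ℂ) := by
    ext a a'
    simpa [Matrix.mul_apply, M, Matrix.one_apply] using hc a a'
  have hc0 : c ≠ 0 := by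
    rintro rfl
    have : M = 0 := by
      rw [zero_smul] at hM
      exact Matrix.self_mul_conjTranspose_eq_zero.1 hM
    exact h0 (funext fun x => by simpa [M] using congrFun (congrFun this x.1) x.2)
  have hM2 : M.conjTranspose * M = c • (1 : Matrix (Fin 2) (Fin 2) ℂ) := by
    have : M * (c⁻¹ • M.conjTranspose) = 1 := by
      rw [Matrix.mul_smul, hM, smul_smul, inv_mul_cancel₀ hc0, one_smul]
    have := mul_eq_one_comm.1 this
    rw [Matrix.smul_mul] at this
    rw [← this, smul_smul, mul_inv_cancel₀ hc0, one_smul]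
  refine ⟨?_, c, fun a a' => ?_⟩
  · obtain ⟨x, hx⟩ := Function.ne_iff.1 h0
    exact Function.ne_iff.2 ⟨(x.2, x.1), hx⟩
  · have := congrFun (congrFun hM2 a') a
    simp only [Matrix.mul_apply, M, Matrix.conjTranspose_apply, Matrix.of_apply, Matrix.smul_apply,
      Matrix.one_apply, smul_eq_mul, mul_ite, mul_one, mul_zero] at this
    simp only [eq_comm (a := a)]
    rw [← this]
    exact sum_congr rfl fun b _ => mul_comm _ _

theorem PFf.peel1 {n : ℕ} {f : Fin n → Fin n} {S : Finset (Fin n)} {v : (Fin n → Fin 2) → ℂ}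
    (h : PFf f S v) {p : Fin n} (hp : p ∈ S) (hfp : f p = p) :
    ∃ (α : Fin 2 → ℂ) (w : (Fin n → Fin 2) → ℂ), PFf f (S.erase p) w ∧
      v = fun s => α (s p) * w s := by
  obtain ⟨h0, hf, hS, c, φ, Φ, h1, h2, h3⟩ := h
  have hv : v = fun s => φ p (s p) * (c * ((∏ i ∈ S.erase p with f i = i, φ i (s i)) *
              (∏ i ∈ S.erase p with i < f i, Φ i (s i, s (f i))))) := by
    funext s
    have e1 : S.filter (fun i => f i = i) = insert p ((S.erase p).filter (fun i => f i = i)) := by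
      ext x; simp only [mem_filter, mem_insert, mem_erase]; grind
    have e2 : S.filter (fun i => i < f i) = ((S.erase p).filter (fun i => i < f i)) := by
      ext x; simp only [mem_filter, mem_erase]; grind
    rw [h3, e1, e2, prod_insert (by simp)]; ring
  refine ⟨φ p, _, ⟨?_, hf, ?_, c, φ, Φ, fun i hi => h1 i (mem_of_mem_erase hi),
    fun i hi => h2 i (mem_of_mem_erase hi), fun s => rfl⟩, hv⟩
  · intro h
    apply h0
    rw [hv]
    funext s
    have := congrFun h s
    simp only [Pi.zero_apply] at this ⊢
    rw [this, mul_zero]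
  · intro i hi
    simp only [mem_erase] at hi ⊢
    exact ⟨fun h => hi.1 (by rw [← hf i, h, hfp]), hS i hi.2⟩

theorem PFf.peel2 {n : ℕ} {f : Fin n → Fin n} {S : Finset (Fin n)} {v : (Fin n → Fin 2) → ℂ}
    (h : PFf f S v) {p : Fin n} (hp : p ∈ S) (hfp : f p ≠ p) :
    ∃ (Ψ : Fin 2 × Fin 2 → ℂ) (w : (Fin n → Fin 2) → ℂ), MaxEnt Ψ ∧
      PFf f ((S.erase p).erase (f p)) w ∧ v = fun s => Ψ (s p, s (f p)) * w s := by
  have main : ∀ p ∈ S, p < f p → ∃ (Ψ : Fin 2 × Fin 2 → ℂ) (w : (Fin n → Fin 2) → ℂ), MaxEnt Ψ ∧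
      PFf f ((S.erase p).erase (f p)) w ∧ v = fun s => Ψ (s p, s (f p)) * w s := by
    clear hfp hp p
    intro p hp hfp
    obtain ⟨h0, hf, hS, c, φ, Φ, h1, h2, h3⟩ := h
    have hv : v = fun s => Φ p (s p, s (f p)) *
        (c * ((∏ i ∈ (S.erase p).erase (f p) with f i = i, φ i (s i)) *
              (∏ i ∈ (S.erase p).erase (f p) with i < f i, Φ i (s i, s (f i))))) := by
      funext s
      have e1 : S.filter (fun i => i < f i) =
          insert p (((S.erase p).erase (f p)).filter (fun i => i < f i)) := by
        ext x; simp only [mem_filter, mem_insert, mem_erase]; grind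
      have e2 : S.filter (fun i => f i = i) =
          (((S.erase p).erase (f p)).filter (fun i => f i = i)) := by
        ext x; simp only [mem_filter, mem_erase]; grind
      rw [h3, e1, e2, prod_insert (by simp)]; ring
    refine ⟨Φ p, _, h2 p hp hfp, ⟨?_, hf, ?_, c, φ, Φ,
      fun i hi => h1 i (mem_of_mem_erase (mem_of_mem_erase hi)),
      fun i hi => h2 i (mem_of_mem_erase (mem_of_mem_erase hi)), fun s => rfl⟩, hv⟩
    · intro h
      apply h0
      rw [hv]
      funext s
      have := congrFun h s
      simp only [Pi.zero_apply] at this ⊢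
      rw [this, mul_zero]
    · intro i hi
      simp only [mem_erase] at hi ⊢
      grind
  rcases lt_or_gt_of_ne hfp with h1 | h1
  · have hf := h.2.1 p
    obtain ⟨Ψ, w, h2, h3, h4⟩ := main (f p) (h.2.2.1 p hp) (by rw [hf]; exact h1)
    refine ⟨_, w, h2.swap, ?_, ?_⟩
    · rw [hf, erase_right_comm] at h3; exact h3
    · rw [hf] at h4; exact h4
  · exact main p hp h1

/-- Mixing lemma for non-vanishing products. -/
theorem mul_ne_of_dep {n : ℕ} {B C : Finset (Fin n)} (hBC : Disjoint B C)
    {u w : (Fin n → Fin 2) → ℂ} (hu : DependsOn u (B : Set (Fin n)))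
    (hw : DependsOn w (C : Set (Fin n))) (hu0 : u ≠ 0) (hw0 : w ≠ 0) :
    (fun s => u s * w s) ≠ 0 := by
  obtain ⟨x, hx⟩ := Function.ne_iff.1 hu0
  obtain ⟨y, hy⟩ := Function.ne_iff.1 hw0
  refine Function.ne_iff.2 ⟨B.piecewise x y, ?_⟩
  have e1 : u (B.piecewise x y) = u x := hu fun i hi => by
    simp [Finset.piecewise_eq_of_mem _ _ _ (by simpa using hi)]
  have e2 : w (B.piecewise x y) = w y := hw fun i hi => by
    rw [Finset.piecewise_eq_of_notMem]
    exact Finset.disjoint_right.1 hBC (by simpa using hi)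
  rw [e1, e2]
  exact mul_ne_zero hx hy

theorem PF.build1 {n : ℕ} {S : Finset (Fin n)} {w : (Fin n → Fin 2) → ℂ}
    (h : PF S w) {p : Fin n} (hp : p ∉ S) {α : Fin 2 → ℂ}
    (h0 : (fun s : Fin n → Fin 2 => α (s p) * w s) ≠ 0) :
    PF (insert p S) (fun s => α (s p) * w s) := by
  obtain ⟨f, -, hf, hS, c, φ, Φ, h1, h2, h3⟩ := h
  have hα : α ≠ 0 := by
    rintro rfl
    exact h0 (by funext s; simp)
  refine ⟨fun x => if x ∈ S then f x else x, h0, ?_, ?_, c, fun i => if i = p then α else φ i, Φ,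
    ?_, ?_, ?_⟩
  · grind
  · grind
  · grind
  · grind
  · intro s
    have e1 : (insert p S).filter (fun i => (if i ∈ S then f i else i) = i) =
        insert p (S.filter (fun i => f i = i)) := by
      ext x; simp only [mem_filter, mem_insert]; grind
    have e2 : (insert p S).filter (fun i => i < (if i ∈ S then f i else i)) =
        (S.filter (fun i => i < f i)) := by
      ext x; simp only [mem_filter, mem_insert]; grind
    have e3 : ∏ i ∈ S with f i = i, (if i = p then α else φ i) (s i) =
        ∏ i ∈ S with f i = i, φ i (s i) := prod_congr rfl fun i hi => by
      rw [if_neg]; rintro rfl; exact hp (mem_filter.1 hi).1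
    have e4 : ∏ i ∈ S with i < f i, Φ i (s i, s (if i ∈ S then f i else i)) =
        ∏ i ∈ S with i < f i, Φ i (s i, s (f i)) := prod_congr rfl fun i hi => by
      rw [if_pos (mem_filter.1 hi).1]
    simp only [e1, e2]
    rw [prod_insert (by simp [hp]), e3, e4, h3]
    simp only [if_true]
    ring

theorem PF.build2 {n : ℕ} {S : Finset (Fin n)} {w : (Fin n → Fin 2) → ℂ}
    (h : PF S w) {p q : Fin n} (hp : p ∉ S) (hq : q ∉ S) (hpq : p ≠ q) {Ψ : Fin 2 × Fin 2 → ℂ}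
    (hΨ : MaxEnt Ψ) (h0 : (fun s : Fin n → Fin 2 => Ψ (s p, s q) * w s) ≠ 0) :
    PF (insert p (insert q S)) (fun s => Ψ (s p, s q) * w s) := by
  wlog hlt : p < q generalizing p q Ψ
  · have := this hq hp hpq.symm hΨ.swap h0 (lt_of_le_of_ne (not_lt.1 hlt) hpq.symm)
    rw [Finset.insert_comm] at this
    exact this
  obtain ⟨f, -, hf, hS, c, φ, Φ, h1, h2, h3⟩ := h
  refine ⟨fun x => if x ∈ S then f x else if x = p then q else if x = q then p else x,
    h0, ?_, ?_, c, φ, fun i => if i = p then Ψ else Φ i, ?_, ?_, ?_⟩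
  · grind
  · grind
  · grind
  · intro i hi hi2
    by_cases hip : i = p
    · simpa [hip] using hΨ
    · simp only [if_neg hip]
      apply h2 <;> grind
  · intro s
    have e1 : (insert p (insert q S)).filter (fun i => (if i ∈ S then f i else
          if i = p then q else if i = q then p else i) = i) =
        (S.filter (fun i => f i = i)) := by
      ext x; simp only [mem_filter, mem_insert]; grind
    have e2 : (insert p (insert q S)).filter (fun i => i < (if i ∈ S then f i else
          if i = p then q else if i = q then p else i)) =
        insert p (S.filter (fun i => i < f i)) := by
      ext x; simp only [mem_filter, mem_insert]; grind
    have e4 : ∏ i ∈ S with i < f i, (if i = p then Ψ else Φ i) (s i, s (if i ∈ S then f i else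
          if i = p then q else if i = q then p else i)) =
        ∏ i ∈ S with i < f i, Φ i (s i, s (f i)) := prod_congr rfl fun i hi => by
      rw [if_pos (mem_filter.1 hi).1, if_neg]; rintro rfl; exact hp (mem_filter.1 hi).1
    simp only [e1, e2]
    rw [prod_insert (by simp [hp]), e4, h3]
    simp only [if_true, hp, if_false]
    ring

/-- A real linear combination of two vectors. -/
def comb {n : ℕ} (ψ φ : (Fin n → Fin 2) → ℂ) (a b : ℝ) : (Fin n → Fin 2) → ℂ :=
  fun s => (a : ℂ) * ψ s + (b : ℂ) * φ s

/-- Pairwise non-proportional points. -/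
def NP (T : Finset (ℝ × ℝ)) : Prop :=
  ∀ s ∈ T, ∀ t ∈ T, s ≠ t → s.1 * t.2 - s.2 * t.1 ≠ 0

theorem quad {T : Finset (ℝ × ℝ)} (hT : NP T) (h3 : 3 ≤ #T) (F : ℝ → ℝ → ℂ) (α β γ : ℂ)
    (hF : ∀ a b : ℝ, F a b = α * a ^ 2 + β * (a * b) + γ * b ^ 2)
    (h : ∀ t ∈ T, F t.1 t.2 = 0) (a b : ℝ) : F a b = 0 := by
  obtain ⟨U, hU, hU3⟩ := exists_subset_card_eq h3
  obtain ⟨x, y, z, hxy, hxz, hyz, rfl⟩ := card_eq_three.1 hU3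
  have hx : x ∈ T := hU (by simp)
  have hy : y ∈ T := hU (by simp)
  have hz : z ∈ T := hU (by simp)
  have d1 := hT x hx y hy hxy
  have d2 := hT x hx z hz hxz
  have d3 := hT y hy z hz hyz
  have hD : ((((x.1 * y.2 - x.2 * y.1) * (x.1 * z.2 - x.2 * z.1) * (y.1 * z.2 - y.2 * z.1) : ℝ)) : ℂ)
      ≠ 0 := by
    exact_mod_cast mul_ne_zero (mul_ne_zero d1 d2) d3
  have e1 := h x hx
  have e2 := h y hy
  have e3 := h z hz
  rw [hF] at e1 e2 e3 ⊢
  push_cast at hD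
  refine (mul_eq_zero.1 ?_).resolve_right hD
  linear_combination
    ((a * y.2 - b * y.1) * (a * z.2 - b * z.1) * (y.1 * z.2 - y.2 * z.1) : ℂ) * e1 -
    ((a * x.2 - b * x.1) * (a * z.2 - b * z.1) * (x.1 * z.2 - x.2 * z.1) : ℂ) * e2 +
    ((a * x.2 - b * x.1) * (a * y.2 - b * y.1) * (x.1 * y.2 - x.2 * y.1) : ℂ) * e3

def Minors {n : ℕ} (B : Finset (Fin n)) (v : (Fin n → Fin 2) → ℂ) : Prop :=
  ∀ s s' r r', v (B.piecewise s r) * v (B.piecewise s' r') =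
    v (B.piecewise s' r) * v (B.piecewise s r')

theorem minors_lift {n : ℕ} (B : Finset (Fin n)) {T : Finset (ℝ × ℝ)} (hT : NP T) (h3 : 3 ≤ #T)
    (ψ φ : (Fin n → Fin 2) → ℂ) (h : ∀ t ∈ T, Minors B (comb ψ φ t.1 t.2)) (a b : ℝ) :
    Minors B (comb ψ φ a b) := by
  intro s s' r r'
  rw [← sub_eq_zero]
  refine quad hT h3 (fun a b => comb ψ φ a b (B.piecewise s r) * comb ψ φ a b (B.piecewise s' r') -
    comb ψ φ a b (B.piecewise s' r) * comb ψ φ a b (B.piecewise s r')) 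
    (ψ (B.piecewise s r) * ψ (B.piecewise s' r') - ψ (B.piecewise s' r) * ψ (B.piecewise s r'))
    (ψ (B.piecewise s r) * φ (B.piecewise s' r') - ψ (B.piecewise s' r) * φ (B.piecewise s r') +
     φ (B.piecewise s r) * ψ (B.piecewise s' r') - φ (B.piecewise s' r) * ψ (B.piecewise s r'))
    (φ (B.piecewise s r) * φ (B.piecewise s' r') - φ (B.piecewise s' r) * φ (B.piecewise s r'))
    ?_ ?_ a b
  · intro a b
    simp only [comb]; ring
  · intro t ht
    exact sub_eq_zero.2 (h t ht s s' r r')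

def Mixed {n : ℕ} (p : Fin n) (v : (Fin n → Fin 2) → ℂ) : Prop :=
  (∑ s, v (Function.update s p 0) * (starRingEnd ℂ) (v (Function.update s p 1))) = 0 ∧
  (∑ s, v (Function.update s p 0) * (starRingEnd ℂ) (v (Function.update s p 0))) =
  (∑ s, v (Function.update s p 1) * (starRingEnd ℂ) (v (Function.update s p 1)))

theorem sesq {n : ℕ} (ψ φ : (Fin n → Fin 2) → ℂ) (x y : (Fin n → Fin 2) → (Fin n → Fin 2)) :
    ∃ α β γ : ℂ, ∀ a b : ℝ,
      (∑ s, comb ψ φ a b (x s) * (starRingEnd ℂ) (comb ψ φ a b (y s))) =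
      α * a ^ 2 + β * (a * b) + γ * b ^ 2 := by
  refine ⟨∑ s, ψ (x s) * (starRingEnd ℂ) (ψ (y s)),
    ∑ s, (ψ (x s) * (starRingEnd ℂ) (φ (y s)) + φ (x s) * (starRingEnd ℂ) (ψ (y s))),
    ∑ s, φ (x s) * (starRingEnd ℂ) (φ (y s)), fun a b => ?_⟩
  rw [sum_mul, sum_mul, sum_mul, ← sum_add_distrib, ← sum_add_distrib]
  refine sum_congr rfl fun s _ => ?_
  simp only [comb, map_add, map_mul, Complex.conj_ofReal]
  ring

theorem mixed_lift {n : ℕ} (p : Fin n) {T : Finset (ℝ × ℝ)} (hT : NP T) (h3 : 3 ≤ #T)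
    (ψ φ : (Fin n → Fin 2) → ℂ) (h : ∀ t ∈ T, Mixed p (comb ψ φ t.1 t.2)) (a b : ℝ) :
    Mixed p (comb ψ φ a b) := by
  obtain ⟨α, β, γ, h1⟩ := sesq ψ φ (fun s => Function.update s p 0) (fun s => Function.update s p 1)
  obtain ⟨α', β', γ', h2⟩ :=
    sesq ψ φ (fun s => Function.update s p 0) (fun s => Function.update s p 0)
  obtain ⟨α'', β'', γ'', h4⟩ :=
    sesq ψ φ (fun s => Function.update s p 1) (fun s => Function.update s p 1)
  constructor
  · exact quad hT h3 _ α β γ h1 (fun t ht => (h t ht).1) a b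
  · rw [← sub_eq_zero]
    exact quad hT h3 (fun a b =>
      (∑ s, comb ψ φ a b (Function.update s p 0) *
        (starRingEnd ℂ) (comb ψ φ a b (Function.update s p 0))) -
      (∑ s, comb ψ φ a b (Function.update s p 1) *
        (starRingEnd ℂ) (comb ψ φ a b (Function.update s p 1)))) (α' - α'') (β' - β'') (γ' - γ'')
      (fun a b => by rw [h2, h4]; ring) (fun t ht => sub_eq_zero.2 (h t ht).2) a b

theorem dep_update {n : ℕ} {C : Finset (Fin n)} {w : (Fin n → Fin 2) → ℂ}
    (hw : DependsOn w (C : Set (Fin n))) {p : Fin n} (hp : p ∉ C) (s : Fin n → Fin 2) (x : Fin 2) :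
    w (Function.update s p x) = w s :=
  hw fun i hi => by
    rw [Function.update_of_ne]; rintro rfl; exact hp (by simpa using hi)

theorem norm_sum_ne {n : ℕ} {w : (Fin n → Fin 2) → ℂ} (hw : w ≠ 0) :
    (∑ s, w s * (starRingEnd ℂ) (w s)) ≠ 0 := by
  simp only [Complex.mul_conj]
  rw [← Complex.ofReal_sum]
  intro h
  rw [Complex.ofReal_eq_zero, sum_eq_zero_iff_of_nonneg fun _ _ => Complex.normSq_nonneg _] at h
  exact hw (funext fun s => by simpa using h s (mem_univ s))

theorem sum_pair {n : ℕ} (q : Fin n) (W : (Fin n → Fin 2) → ℂ)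
    (hW : ∀ s x, W (Function.update s q x) = W s) (G : Fin 2 → ℂ) :
    2 * ∑ s, G (s q) * W s = (∑ b, G b) * ∑ s, W s := by
  let e : (Fin n → Fin 2) → (Fin n → Fin 2) := fun s => Function.update s q (1 - s q)
  have he : Function.Involutive e := by
    intro s
    simp [e]
  have h := Equiv.sum_comp (he.toPerm e) (fun s => G (s q) * W s)
  have h' : ∀ s, (he.toPerm e) s = e s := fun s => rfl
  simp only [h', e, hW, Function.update_self] at h
  rw [two_mul]
  nth_rewrite 1 [← h]
  rw [← sum_add_distrib, mul_sum]
  refine sum_congr rfl fun s _ => ?_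
  rw [Fin.sum_univ_two]
  generalize s q = x
  fin_cases x <;> simp <;> ring

theorem mixed_iff {n : ℕ} {C : Finset (Fin n)} {w : (Fin n → Fin 2) → ℂ}
    (hw : DependsOn w (C : Set (Fin n))) (hw0 : w ≠ 0) {p q : Fin n} (hp : p ∉ C) (hq : q ∉ C)
    (hpq : p ≠ q) {Ψ : Fin 2 × Fin 2 → ℂ} (hΨ : Ψ ≠ 0) :
    Mixed p (fun s => Ψ (s p, s q) * w s) ↔ MaxEnt Ψ := by
  have key : ∀ x y : Fin 2, 2 * ∑ s : Fin n → Fin 2, (Ψ (x, s q) * w s) *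
      (starRingEnd ℂ) (Ψ (y, s q) * w s) = (∑ b, Ψ (x, b) * (starRingEnd ℂ) (Ψ (y, b))) *
        ∑ s, w s * (starRingEnd ℂ) (w s) := by
    intro x y
    rw [← sum_pair q (fun s => w s * (starRingEnd ℂ) (w s)) _
      (fun b => Ψ (x, b) * (starRingEnd ℂ) (Ψ (y, b)))]
    · congr 1
      refine sum_congr rfl fun s _ => ?_
      rw [map_mul]; ring
    · intro s x
      rw [dep_update hw hq]
  have hN := norm_sum_ne hw0
  rw [maxEnt_iff]
  simp only [Mixed, Function.update_self, Function.update_of_ne hpq.symm, dep_update hw hp]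
  rw [← mul_right_inj' (two_ne_zero (α := ℂ)), key, ← mul_right_inj' (two_ne_zero (α := ℂ)) (b := ∑ s : Fin n → Fin 2, (Ψ (0, s q) * w s) *
      (starRingEnd ℂ) (Ψ (0, s q) * w s)), key, key, mul_left_inj' hN, mul_zero, mul_eq_zero]
  simp [hN, hΨ]

theorem not_mixed {n : ℕ} {f : Fin n → Fin n} {S : Finset (Fin n)} {v : (Fin n → Fin 2) → ℂ}
    (h : PFf f S v) {p : Fin n} (hp : p ∈ S) (hfp : f p = p) (hm : Mixed p v) : False := by
  obtain ⟨α, w, hw, rfl⟩ := h.peel1 hp hfp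
  have hN := norm_sum_ne hw.1
  obtain ⟨m1, m2⟩ := hm
  have key : ∀ x y : Fin 2, ∑ s, (α x * w s) * (starRingEnd ℂ) (α y * w s) =
      (α x * (starRingEnd ℂ) (α y)) * ∑ s, w s * (starRingEnd ℂ) (w s) := by
    intro x y
    rw [mul_sum]
    refine sum_congr rfl fun s _ => ?_
    rw [map_mul]; ring
  simp only [Function.update_self, dep_update hw.dep (notMem_erase p S), key] at m1 m2
  have m1' := (mul_eq_zero.1 m1).resolve_right hN
  have m2' := mul_right_cancel₀ hN m2
  have : α 0 = 0 ∧ α 1 = 0 := by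
    rcases mul_eq_zero.1 m1' with h | h
    · rw [h] at m2'
      simpa [h] using m2'.symm
    · simp only [map_eq_zero] at h
      rw [h] at m2'
      simpa [h] using m2'
  apply h.1
  funext s
  have : α (s p) = 0 := by
    generalize s p = x
    fin_cases x <;> simp [this]
  simp [this]

theorem minors_pair {n : ℕ} {f : Fin n → Fin n} {S B : Finset (Fin n)} {v : (Fin n → Fin 2) → ℂ}
    (h : PFf f S v) {p : Fin n} (hp : p ∈ S) (hpB : p ∈ B) (hm : Minors B v) : f p ∈ B := by
  by_contra hfB
  have hfp : f p ≠ p := fun h' => hfB (h'.symm ▸ hpB)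
  obtain ⟨Ψ, w, hΨ, hw, rfl⟩ := h.peel2 hp hfp
  obtain ⟨r, hr⟩ := Function.ne_iff.1 hw.1
  have key : ∀ x y, B.piecewise (Function.update r p x) (Function.update r (f p) y) =
      Function.update (Function.update r p x) (f p) y := by
    intro x y
    funext i
    simp only [Finset.piecewise, Function.update]
    grind
  have := hm (Function.update r p 0) (Function.update r p 1) (Function.update r (f p) 0)
    (Function.update r (f p) 1)
  simp only [key, Function.update_self, Function.update_of_ne hfp.symm,
    dep_update hw.dep (notMem_erase (f p) _)] at this
  rw [dep_update hw.dep (by simp), dep_update hw.dep (by simp)] at this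
  apply hΨ.det
  have hr2 := mul_ne_zero hr hr
  refine mul_right_cancel₀ hr2 ?_
  simp only [Pi.zero_apply] at *
  linear_combination this

theorem pw_left {n : ℕ} {B : Finset (Fin n)} {u : (Fin n → Fin 2) → ℂ}
    (hu : DependsOn u (B : Set (Fin n))) (s r : Fin n → Fin 2) : u (B.piecewise s r) = u s :=
  hu fun i hi => Finset.piecewise_eq_of_mem _ _ _ (by simpa using hi)

theorem pw_right {n : ℕ} {S B : Finset (Fin n)} {w : (Fin n → Fin 2) → ℂ}
    (hw : DependsOn w ((S \ B : Finset (Fin n)) : Set (Fin n))) (s r : Fin n → Fin 2) :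
    w (B.piecewise s r) = w r :=
  hw fun i hi => Finset.piecewise_eq_of_notMem _ _ _ (by simp at hi; exact hi.2)

/-- Statement for a set of qubits. -/
def Main {n : ℕ} (S : Finset (Fin n)) : Prop :=
  ∀ (ψ φ : (Fin n → Fin 2) → ℂ) (T : Finset (ℝ × ℝ)), PF S ψ → PF S φ → NP T → 21 ≤ #T →
    (∀ t ∈ T, PF S (comb ψ φ t.1 t.2)) → ∀ a b : ℝ, comb ψ φ a b ≠ 0 → PF S (comb ψ φ a b)

theorem minors_mul {n : ℕ} {S B : Finset (Fin n)} {u w : (Fin n → Fin 2) → ℂ}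
    (hu : DependsOn u (B : Set (Fin n)))
    (hw : DependsOn w ((S \ B : Finset (Fin n)) : Set (Fin n))) :
    Minors B (fun s => u s * w s) := by
  intro s s' r r'
  simp only [pw_left hu, pw_right hw]; ring

theorem step {n : ℕ} {S B : Finset (Fin n)} (Cond : ((Fin n → Fin 2) → ℂ) → Prop)
    (hdec : ∀ v, PF S v → Cond v → ∃ u w, DependsOn u (B : Set (Fin n)) ∧ PF (S \ B) w ∧
      v = fun s => u s * w s)
    (hmin : ∀ v, Cond v → Minors B v)
    (hbuild : ∀ u w, DependsOn u (B : Set (Fin n)) → PF (S \ B) w →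
      Cond (fun s => u s * w s) → (fun s => u s * w s) ≠ 0 → PF S (fun s => u s * w s))
    (IH : Main (S \ B))
    (ψ φ : (Fin n → Fin 2) → ℂ) (T : Finset (ℝ × ℝ)) (hψ : PF S ψ) (hφ : PF S φ) (hNP : NP T)
    (hT : 21 ≤ #T) (hP : ∀ t ∈ T, PF S (comb ψ φ t.1 t.2))
    (hC : ∀ a b : ℝ, Cond (comb ψ φ a b)) (a b : ℝ) (hab : comb ψ φ a b ≠ 0) :
    PF S (comb ψ φ a b) := by
  have cψ : Cond ψ := by
    have := hC 1 0
    rwa [show comb ψ φ 1 0 = ψ from funext fun s => by simp [comb]] at this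
  have cφ : Cond φ := by
    have := hC 0 1
    rwa [show comb ψ φ 0 1 = φ from funext fun s => by simp [comb]] at this
  obtain ⟨u, w, hu, hw, rfl⟩ := hdec ψ hψ cψ
  obtain ⟨u', w', hu', hw', rfl⟩ := hdec φ hφ cφ
  have key : ∀ s s' r r', (u s * u' s' - u s' * u' s) * (w r * w' r' - w' r * w r') = 0 := by
    intro s s' r r'
    have := hmin _ (hC 1 1) s s' r r'
    simp only [comb, pw_left hu, pw_left hu', pw_right hw.dep, pw_right hw'.dep] at this
    push_cast at this
    linear_combination this
  by_cases huu : ∀ s s', u s * u' s' - u s' * u' s = 0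
  · have hu0 : u ≠ 0 := by
      rintro rfl; exact hψ.ne (funext fun s => by simp)
    obtain ⟨s0, hs0⟩ := Function.ne_iff.1 hu0
    simp only [Pi.zero_apply] at hs0
    obtain ⟨l, hl⟩ : ∃ l, ∀ s, u' s = l * u s := ⟨u' s0 / u s0, fun s => by
      field_simp; linear_combination huu s0 s⟩
    have hl0 : l ≠ 0 := by
      rintro rfl; exact hφ.ne (funext fun s => by simp [hl])
    have hcomb : ∀ a b, comb (fun s => u s * w s) (fun s => u' s * w' s) a b =
        fun s => u s * comb w (fun s => l * w' s) a b s := by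
      intro a b; funext s; simp only [comb, hl]; ring
    have hlw := hw'.smul hl0
    have hdep : ∀ a b, DependsOn (comb w (fun s => l * w' s) a b)
        ((S \ B : Finset (Fin n)) : Set (Fin n)) := by
      intro a b x y hxy
      simp only [comb, hw.dep hxy, hw'.dep hxy]
    have hne : ∀ a b, comb (fun s => u s * w s) (fun s => u' s * w' s) a b ≠ 0 →
        comb w (fun s => l * w' s) a b ≠ 0 := by
      intro a b h1 h2
      rw [hcomb, h2] at h1
      exact h1 (by funext s; simp)
    have := IH w (fun s => l * w' s) T hw hlw hNP hT ?_ a b (hne a b hab)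
    · have hc := hC a b
      rw [hcomb] at hab hc ⊢
      exact hbuild _ _ hu this hc hab
    · intro t ht
      have h1 := hP t ht
      obtain ⟨u2, w2, hu2, hw2, h2⟩ := hdec _ h1 (hC _ _)
      have h0 := hne _ _ h1.ne
      rw [hcomb] at h2
      have h3 : comb w (fun s => l * w' s) t.1 t.2 = fun r => (u2 s0 / u s0) * w2 r := by
        funext r
        have := congrFun h2 (B.piecewise s0 r)
        simp only [pw_left hu, pw_left hu2, pw_right hw2.dep, pw_right (hdep _ _)] at this
        field_simp
        linear_combination this
      rw [h3] at h0 ⊢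
      apply hw2.smul
      intro h4
      exact h0 (by funext r; simp [h4])
  · push Not at huu
    obtain ⟨s, s', hss⟩ := huu
    have hww : ∀ r r', w r * w' r' - w' r * w r' = 0 := fun r r' =>
      (mul_eq_zero.1 (key s s' r r')).resolve_left hss
    obtain ⟨r0, hr0⟩ := Function.ne_iff.1 hw.ne
    simp only [Pi.zero_apply] at hr0
    obtain ⟨l, hl⟩ : ∃ l, ∀ s, w' s = l * w s := ⟨w' r0 / w r0, fun s => by
      field_simp; linear_combination hww r0 s⟩
    have hcomb : comb (fun s => u s * w s) (fun s => u' s * w' s) a b =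
        fun s => comb u (fun s => l * u' s) a b s * w s := by
      funext s; simp only [comb, hl]; ring
    have hc := hC a b
    rw [hcomb] at hab hc ⊢
    refine hbuild _ _ ?_ hw hc hab
    intro x y hxy
    simp only [comb, hu hxy, hu' hxy]

theorem step1 {n : ℕ} {S : Finset (Fin n)} {p : Fin n} (hp : p ∈ S) (IH : Main (S \ {p}))
    (ψ φ : (Fin n → Fin 2) → ℂ) (T U : Finset (ℝ × ℝ)) (hψ : PF S ψ) (hφ : PF S φ) (hNP : NP T)
    (hT : 21 ≤ #T) (hP : ∀ t ∈ T, PF S (comb ψ φ t.1 t.2)) (hUT : U ⊆ T) (hU : 3 ≤ #U)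
    (hUf : ∀ t ∈ U, ∃ f, PFf f S (comb ψ φ t.1 t.2) ∧ f p = p)
    (a b : ℝ) (hab : comb ψ φ a b ≠ 0) : PF S (comb ψ φ a b) := by
  have hdepα : ∀ α : Fin 2 → ℂ, DependsOn (fun s : Fin n → Fin 2 => α (s p))
      (({p} : Finset (Fin n)) : Set (Fin n)) := by
    intro α x y hxy
    simp only [hxy p (by simp)]
  have dec : ∀ f v, PFf f S v → f p = p → ∃ u w, DependsOn u (({p} : Finset (Fin n)) : Set (Fin n))
      ∧ PF (S \ {p}) w ∧ v = fun s => u s * w s := by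
    intro f v hv hf
    obtain ⟨α, w, hw, h⟩ := hv.peel1 hp hf
    refine ⟨_, w, hdepα α, ⟨f, ?_⟩, h⟩
    rwa [sdiff_singleton_eq_erase]
  refine step (B := {p}) (Minors {p}) ?_ (fun v h => h) ?_ IH ψ φ T hψ hφ hNP hT hP
    (minors_lift _ (T := U) (fun s hs t ht => hNP s (hUT hs) t (hUT ht)) hU ψ φ ?_) a b hab
  · rintro v ⟨f, hv⟩ hm
    exact dec f v hv (by simpa using minors_pair hv hp (mem_singleton_self p) hm)
  · intro u w hu hw _ h0
    have hu' : u = fun s => (fun x => u (fun _ => x)) (s p) := by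
      funext s
      apply hu
      simp
    rw [hu'] at h0 ⊢
    have := hw.build1 (p := p) (by simp) h0
    rwa [show insert p (S \ {p}) = S by ext; simp; grind] at this
  · intro t ht
    obtain ⟨f, hv, hf⟩ := hUf t ht
    obtain ⟨u, w, hu, hw, h⟩ := dec f _ hv hf
    rw [h]
    exact minors_mul hu hw.dep

theorem pair_mixed {n : ℕ} {f : Fin n → Fin n} {S : Finset (Fin n)} {v : (Fin n → Fin 2) → ℂ}
    (h : PFf f S v) {p : Fin n} (hp : p ∈ S) (hfp : f p ≠ p) : Mixed p v := by
  obtain ⟨Ψ, w, hΨ, hw, h⟩ := h.peel2 hp hfp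
  rw [h]
  exact (mixed_iff hw.dep hw.1 (by simp) (by simp) hfp.symm hΨ.1).2 hΨ

theorem step2 {n : ℕ} {S : Finset (Fin n)} {p q : Fin n} (hp : p ∈ S) (hq : q ∈ S) (hpq : p ≠ q)
    (IH : Main (S \ {p, q}))
    (ψ φ : (Fin n → Fin 2) → ℂ) (T U : Finset (ℝ × ℝ)) (hψ : PF S ψ) (hφ : PF S φ) (hNP : NP T)
    (hT : 21 ≤ #T) (hP : ∀ t ∈ T, PF S (comb ψ φ t.1 t.2)) (hUT : U ⊆ T) (hU : 3 ≤ #U)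
    (hUf : ∀ t ∈ U, ∃ f, PFf f S (comb ψ φ t.1 t.2) ∧ f p = q)
    (a b : ℝ) (hab : comb ψ φ a b ≠ 0) : PF S (comb ψ φ a b) := by
  have hdepα : ∀ α : Fin 2 × Fin 2 → ℂ, DependsOn (fun s : Fin n → Fin 2 => α (s p, s q))
      (({p, q} : Finset (Fin n)) : Set (Fin n)) := by
    intro α x y hxy
    simp only [hxy p (by simp), hxy q (by simp)]
  have dec : ∀ f v, PFf f S v → f p = q →
      ∃ u w, DependsOn u (({p, q} : Finset (Fin n)) : Set (Fin n))
      ∧ PF (S \ {p, q}) w ∧ v = fun s => u s * w s := by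
    intro f v hv hf
    obtain ⟨α, w, -, hw, h⟩ := hv.peel2 hp (by rw [hf]; exact hpq.symm)
    rw [hf] at hw h
    refine ⟨_, w, hdepα α, ⟨f, ?_⟩, h⟩
    rwa [show S \ {p, q} = (S.erase p).erase q by ext; simp; tauto]
  have hUNP : NP U := fun s hs t ht => hNP s (hUT hs) t (hUT ht)
  refine step (B := {p, q}) (fun v => Minors {p, q} v ∧ Mixed p v) ?_ (fun v h => h.1) ?_ IH
    ψ φ T hψ hφ hNP hT hP
    (fun a b => ⟨minors_lift _ hUNP hU ψ φ ?_ a b, mixed_lift _ hUNP hU ψ φ ?_ a b⟩) a b hab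
  · rintro v ⟨f, hv⟩ hm
    have h1 := minors_pair hv hp (by simp) hm.1
    simp only [mem_insert, mem_singleton] at h1
    exact dec f v hv (h1.resolve_left fun h => not_mixed hv hp h hm.2)
  · intro u w hu hw hm h0
    have hu' : u = fun s => (fun x : Fin 2 × Fin 2 => u (fun i => if i = p then x.1 else x.2))
        (s p, s q) := by
      funext s
      apply hu
      intro i hi
      simp at hi
      rcases hi with rfl | rfl
      · simp
      · simp [hpq.symm]
    rw [hu'] at h0 hm ⊢
    have hΨ := (mixed_iff hw.dep hw.ne (by simp) (by simp) hpq (by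
      intro h
      apply h0
      funext s
      have := congrFun h (s p, s q)
      simp only [Pi.zero_apply] at this ⊢
      rw [this, zero_mul])).1 hm.2
    have := hw.build2 (p := p) (q := q) (by simp) (by simp) hpq hΨ h0
    rwa [show insert p (insert q (S \ {p, q})) = S by ext; simp; grind] at this
  · intro t ht
    obtain ⟨f, hv, hf⟩ := hUf t ht
    obtain ⟨u, w, hu, hw, h⟩ := dec f _ hv hf
    rw [h]
    exact minors_mul hu hw.dep
  · intro t ht
    obtain ⟨f, hv, hf⟩ := hUf t ht
    exact pair_mixed hv hp (by rw [hf]; exact hpq.symm)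

theorem inv1 {Ψ : Fin 2 × Fin 2 → ℂ} (h : MaxEnt Ψ) {g : Fin 2 → ℂ}
    (hg : ∀ y, ∑ x, g x * Ψ (x, y) = 0) (x : Fin 2) : g x = 0 := by
  have h0 := hg 0
  have h1 := hg 1
  rw [Fin.sum_univ_two] at h0 h1
  refine (mul_eq_zero.1 ?_).resolve_right h.det
  fin_cases x
  · simp only [Fin.zero_eta]
    linear_combination Ψ (1, 1) * h0 - Ψ (1, 0) * h1
  · simp only [Fin.mk_one]
    linear_combination Ψ (0, 0) * h1 - Ψ (0, 1) * h0

theorem rank2 {n : ℕ} {S C1 C2 : Finset (Fin n)} {i k : Fin n} (hik : i ≠ k)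
    {Φ Φ' : Fin 2 × Fin 2 → ℂ} {ψ φ : (Fin n → Fin 2) → ℂ}
    (hψ : DependsOn ψ (C1 : Set (Fin n))) (hφ : DependsOn φ (C2 : Set (Fin n)))
    (hi1 : i ∉ C1) (hk1 : k ∉ C1) (hi2 : i ∉ C2) (hk2 : k ∉ C2) {F : Fin n → Fin n} {a b : ℝ}
    (hF : PFf F S (comb (fun s => Φ (s i, s k) * ψ s) (fun s => Φ' (s i, s k) * φ s) a b))
    (hi : i ∈ S) (hk : k ∈ S) (h1 : F i ≠ i) (h2 : F k ≠ k) (h3 : F i ≠ k) : False := by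
  obtain ⟨x, hx0, hx1, hx2⟩ : ∃ x : Fin 2 × Fin 2 → ℂ, x ≠ 0 ∧
      (∑ y, ∑ z, x (y, z) * Φ (y, z) = 0) ∧ (∑ y, ∑ z, x (y, z) * Φ' (y, z) = 0) := by
    let L : (Fin 2 × Fin 2 → ℂ) →ₗ[ℂ] (ℂ × ℂ) :=
      { toFun := fun x => (∑ y, ∑ z, x (y, z) * Φ (y, z), ∑ y, ∑ z, x (y, z) * Φ' (y, z))
        map_add' := by
          intro x y
          simp only [Pi.add_apply, add_mul, sum_add_distrib, Prod.mk_add_mk]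
        map_smul' := by
          intro c x
          simp only [Pi.smul_apply, smul_eq_mul, mul_assoc, ← mul_sum, RingHom.id_apply,
            Prod.smul_mk] }
    have := LinearMap.ker_ne_bot_of_finrank_lt (f := L) (by simp)
    obtain ⟨x, hx, hx0⟩ := Submodule.exists_mem_ne_zero_of_ne_bot this
    have hx' : L x = 0 := hx
    exact ⟨x, hx0, congrArg Prod.fst hx', congrArg Prod.snd hx'⟩
  have hinv := hF.2.1
  obtain ⟨Ψ1, w1, m1, hw1, e1⟩ := hF.peel2 hi h1
  have hk' : k ∈ (S.erase i).erase (F i) := by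
    simp [hk, hik.symm, h3.symm]
  obtain ⟨Ψ2, w, m2, hw, e2⟩ := hw1.peel2 hk' h2
  subst e2
  have h4 : F k ≠ i := fun h => h3 (by rw [← h, hinv])
  have h5 : F i ≠ F k := fun h => hik (by rw [← hinv i, h, hinv])
  have key : ∀ s : Fin n → Fin 2,
      (∑ y, ∑ z, x (y, z) * (Ψ1 (y, s (F i)) * Ψ2 (z, s (F k)))) * w s = 0 := by
    intro s
    have e3 : ∀ y z, Ψ1 (y, s (F i)) * (Ψ2 (z, s (F k)) * w s) =
        a * (Φ (y, z) * ψ s) + b * (Φ' (y, z) * φ s) := by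
      intro y z
      have := congrFun e1 (Function.update (Function.update s i y) k z)
      simp only [comb, Function.update_self, Function.update_of_ne hik, Function.update_of_ne h3,
        Function.update_of_ne h1, Function.update_of_ne h2, Function.update_of_ne h4,
        dep_update hψ hi1, dep_update hψ hk1, dep_update hφ hi2, dep_update hφ hk2] at this
      rw [dep_update hw.dep (by simp), dep_update hw.dep (by simp)] at this
      exact this.symm
    have : (∑ y, ∑ z, x (y, z) * (Ψ1 (y, s (F i)) * Ψ2 (z, s (F k)))) * w s =
        (∑ y, ∑ z, x (y, z) * Φ (y, z)) * (a * ψ s) +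
        (∑ y, ∑ z, x (y, z) * Φ' (y, z)) * (b * φ s) := by
      simp only [sum_mul, ← sum_add_distrib]
      refine sum_congr rfl fun y _ => sum_congr rfl fun z _ => ?_
      linear_combination x (y, z) * e3 y z
    rw [this, hx1, hx2]; ring
  obtain ⟨r, hr⟩ := Function.ne_iff.1 hw.1
  have key2 : ∀ y' z', ∑ y, (∑ z, x (y, z) * Ψ2 (z, z')) * Ψ1 (y, y') = 0 := by
    intro y' z'
    have := key (Function.update (Function.update r (F i) y') (F k) z')
    simp only [Function.update_self, Function.update_of_ne h5] at this
    rw [dep_update hw.dep (by simp), dep_update hw.dep (by simp)] at this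
    have := (mul_eq_zero.1 this).resolve_right hr
    rw [← this]
    simp only [sum_mul]
    refine sum_congr rfl fun y _ => sum_congr rfl fun z _ => by ring
  apply hx0
  funext ⟨y, z⟩
  exact inv1 m2 (g := fun z => x (y, z))
    (fun z' => inv1 m1 (g := fun y => ∑ z, x (y, z) * Ψ2 (z, z')) (fun y' => key2 y' z') y) z

theorem rank3 {n : ℕ} {S C1 C2 : Finset (Fin n)} {i k l : Fin n} (hik : i ≠ k) (hil : i ≠ l)
    (hkl : k ≠ l)
    {Φ Φ' : Fin 2 × Fin 2 → ℂ} {ψ φ : (Fin n → Fin 2) → ℂ}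
    (hψ : DependsOn ψ (C1 : Set (Fin n))) (hφ : DependsOn φ (C2 : Set (Fin n)))
    (hi1 : i ∉ C1) (hk1 : k ∉ C1) (hi2 : i ∉ C2) (hl2 : l ∉ C2) {F : Fin n → Fin n} {a b : ℝ}
    (hF : PFf F S (comb (fun s => Φ (s i, s k) * ψ s) (fun s => Φ' (s i, s l) * φ s) a b))
    (hi : i ∈ S) (hk : k ∈ S) (hl : l ∈ S) (h1 : F i ≠ i) (h2 : F k ≠ k) (h3 : F l ≠ l)
    (h4 : F i ≠ k) (h5 : F i ≠ l) (h6 : F k ≠ l) : False := by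
  obtain ⟨x, hx0, hx1, hx2⟩ : ∃ x : Fin 2 × Fin 2 × Fin 2 → ℂ, x ≠ 0 ∧
      (∀ t, ∑ y, ∑ z, x (y, z, t) * Φ (y, z) = 0) ∧
      (∀ z, ∑ y, ∑ t, x (y, z, t) * Φ' (y, t) = 0) := by
    let L : (Fin 2 × Fin 2 × Fin 2 → ℂ) →ₗ[ℂ] ((Fin 2 → ℂ) × (Fin 2 → ℂ)) :=
      { toFun := fun x => (fun t => ∑ y, ∑ z, x (y, z, t) * Φ (y, z),
          fun z => ∑ y, ∑ t, x (y, z, t) * Φ' (y, t))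
        map_add' := by
          intro x y
          simp only [Pi.add_apply, add_mul, sum_add_distrib, Prod.mk_add_mk]
          rfl
        map_smul' := by
          intro c x
          simp only [Pi.smul_apply, smul_eq_mul, mul_assoc, ← mul_sum, RingHom.id_apply,
            Prod.smul_mk]
          rfl }
    have := LinearMap.ker_ne_bot_of_finrank_lt (f := L) (by simp)
    obtain ⟨x, hx, hx0⟩ := Submodule.exists_mem_ne_zero_of_ne_bot this
    have hx' : L x = 0 := hx
    exact ⟨x, hx0, fun t => congrFun (congrArg Prod.fst hx') t,
      fun t => congrFun (congrArg Prod.snd hx') t⟩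
  have hinv := hF.2.1
  have h7 : F k ≠ i := fun h => h4 (by rw [← h, hinv])
  have h8 : F l ≠ i := fun h => h5 (by rw [← h, hinv])
  have h9 : F l ≠ k := fun h => h6 (by rw [← h, hinv])
  have g1 : F i ≠ F k := fun h => hik (by rw [← hinv i, h, hinv])
  have g2 : F i ≠ F l := fun h => hil (by rw [← hinv i, h, hinv])
  have g3 : F k ≠ F l := fun h => hkl (by rw [← hinv k, h, hinv])
  obtain ⟨Ψ1, w1, m1, hw1, e1⟩ := hF.peel2 hi h1
  have hk' : k ∈ (S.erase i).erase (F i) := by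
    simp [hk, hik.symm, h4.symm]
  obtain ⟨Ψ2, w2, m2, hw2, e2⟩ := hw1.peel2 hk' h2
  subst e2
  have hl' : l ∈ (((S.erase i).erase (F i)).erase k).erase (F k) := by
    simp [hl, hil.symm, hkl.symm, h5.symm, h6.symm]
  obtain ⟨Ψ3, w, m3, hw, e2⟩ := hw2.peel2 hl' h3
  subst e2
  have key : ∀ s : Fin n → Fin 2,
      (∑ y, ∑ z, ∑ t, x (y, z, t) * (Ψ1 (y, s (F i)) * Ψ2 (z, s (F k)) * Ψ3 (t, s (F l)))) * w s
        = 0 := by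
    intro s
    have e3 : ∀ y z t, Ψ1 (y, s (F i)) * (Ψ2 (z, s (F k)) * (Ψ3 (t, s (F l)) * w s)) =
        a * (Φ (y, z) * ψ (Function.update s l t)) +
        b * (Φ' (y, t) * φ (Function.update s k z)) := by
      intro y z t
      have c1 : Function.update (Function.update (Function.update s i y) k z) l t =
        Function.update (Function.update (Function.update s l t) i y) k z := by
        rw [Function.update_comm hkl, Function.update_comm hil]
      have c2 : Function.update (Function.update (Function.update s i y) k z) l t =
        Function.update (Function.update (Function.update s k z) i y) l t := by
        rw [Function.update_comm hik]
      have d1 : ψ (Function.update (Function.update (Function.update s i y) k z) l t) =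
          ψ (Function.update s l t) := by
        rw [c1, dep_update hψ hk1, dep_update hψ hi1]
      have d2 : φ (Function.update (Function.update (Function.update s i y) k z) l t) =
          φ (Function.update s k z) := by
        rw [c2, dep_update hφ hl2, dep_update hφ hi2]
      have := congrFun e1 (Function.update (Function.update (Function.update s i y) k z) l t)
      simp only [comb, d1, d2] at this
      simp only [Function.update_self, Function.update_of_ne hik, Function.update_of_ne hil,
        Function.update_of_ne hkl, Function.update_of_ne h3, Function.update_of_ne h5,
        Function.update_of_ne h6, Function.update_of_ne h7, Function.update_of_ne h8,
        Function.update_of_ne h9,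
        Function.update_of_ne h1, Function.update_of_ne h2, Function.update_of_ne h4] at this
      rw [dep_update hw.dep (by simp), dep_update hw.dep (by simp),
        dep_update hw.dep (by simp)] at this
      exact this.symm
    have : (∑ y, ∑ z, ∑ t, x (y, z, t) *
          (Ψ1 (y, s (F i)) * Ψ2 (z, s (F k)) * Ψ3 (t, s (F l)))) * w s =
        (∑ y, ∑ z, ∑ t, (x (y, z, t) * Φ (y, z)) * (a * ψ (Function.update s l t))) +
        (∑ y, ∑ z, ∑ t, (x (y, z, t) * Φ' (y, t)) * (b * φ (Function.update s k z))) := by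
      simp only [sum_mul, ← sum_add_distrib]
      refine sum_congr rfl fun y _ => sum_congr rfl fun z _ => sum_congr rfl fun t _ => ?_
      linear_combination x (y, z, t) * e3 y z t
    have f1 : (∑ y, ∑ z, ∑ t, (x (y, z, t) * Φ (y, z)) * (a * ψ (Function.update s l t))) =
        ∑ t, (∑ y, ∑ z, x (y, z, t) * Φ (y, z)) * (a * ψ (Function.update s l t)) := by
      simp only [Fin.sum_univ_two]; ring
    have f2 : (∑ y, ∑ z, ∑ t, (x (y, z, t) * Φ' (y, t)) * (b * φ (Function.update s k z))) =
        ∑ z, (∑ y, ∑ t, x (y, z, t) * Φ' (y, t)) * (b * φ (Function.update s k z)) := by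
      simp only [Fin.sum_univ_two]; ring
    rw [this, f1, f2]
    simp only [hx1, hx2, zero_mul, sum_const_zero, add_zero]
  obtain ⟨r, hr⟩ := Function.ne_iff.1 hw.1
  have key2 : ∀ y' z' t', ∑ y, (∑ z, (∑ t, x (y, z, t) * Ψ3 (t, t')) * Ψ2 (z, z')) * Ψ1 (y, y')
      = 0 := by
    intro y' z' t'
    have := key (Function.update (Function.update (Function.update r (F i) y') (F k) z') (F l) t')
    simp only [Function.update_self, Function.update_of_ne g1, Function.update_of_ne g2,
      Function.update_of_ne g3] at this
    rw [dep_update hw.dep (by simp), dep_update hw.dep (by simp),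
        dep_update hw.dep (by simp)] at this
    have := (mul_eq_zero.1 this).resolve_right hr
    rw [← this]
    simp only [sum_mul]
    refine sum_congr rfl fun y _ => sum_congr rfl fun z _ => sum_congr rfl fun t _ => by ring
  apply hx0
  funext ⟨y, z, t⟩
  exact inv1 m3 (g := fun t => x (y, z, t)) (fun t' =>
    inv1 m2 (g := fun z => ∑ t, x (y, z, t) * Ψ3 (t, t')) (fun z' =>
      inv1 m1 (g := fun y => ∑ z, (∑ t, x (y, z, t) * Ψ3 (t, t')) * Ψ2 (z, z'))
        (fun y' => key2 y' z' t') y) z) t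

theorem PF_empty {n : ℕ} {v : (Fin n → Fin 2) → ℂ}
    (h : DependsOn v ((∅ : Finset (Fin n)) : Set (Fin n))) (h0 : v ≠ 0) : PF ∅ v := by
  refine ⟨id, h0, fun _ => rfl, by simp, v 0, fun _ _ => 0, fun _ _ => 0, by simp, by simp, ?_⟩
  intro s
  simp only [filter_empty, prod_empty, mul_one]
  exact h (by simp)

theorem main_all {n : ℕ} (S : Finset (Fin n)) : Main S := by
  induction S using Finset.strongInduction with
  | H S IH =>
  intro ψ φ T hψ hφ hNP hT hP a b hab
  rcases S.eq_empty_or_nonempty with rfl | ⟨i, hi⟩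
  · refine PF_empty ?_ hab
    intro x y hxy
    simp only [comb, hψ.dep hxy, hφ.dep hxy]
  by_contra hcon
  have hF : ∀ t : ℝ × ℝ, ∃ f, t ∈ T → PFf f S (comb ψ φ t.1 t.2) := by
    intro t
    by_cases ht : t ∈ T
    · obtain ⟨f, hf⟩ := hP t ht
      exact ⟨f, fun _ => hf⟩
    · exact ⟨id, fun h => absurd h ht⟩
  choose F hF using hF
  have s1 : ∀ p ∈ S, #{t ∈ T | F t p = p} < 3 := by
    intro p hp
    by_contra h
    refine hcon (step1 hp (IH _ ?_) ψ φ T _ hψ hφ hNP hT hP (filter_subset _ _) (not_lt.1 h)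
      ?_ a b hab)
    · exact sdiff_ssubset (by simpa using hp) (by simp)
    · intro t ht
      exact ⟨F t, hF t (mem_filter.1 ht).1, (mem_filter.1 ht).2⟩
  have s2 : ∀ p ∈ S, ∀ q ∈ S, p ≠ q → #{t ∈ T | F t p = q} < 3 := by
    intro p hp q hq hpq
    by_contra h
    refine hcon (step2 hp hq hpq (IH _ ?_) ψ φ T _ hψ hφ hNP hT hP (filter_subset _ _) (not_lt.1 h)
      ?_ a b hab)
    · refine sdiff_ssubset ?_ (by simp)
      intro x; simp only [mem_insert, mem_singleton]; rintro (rfl | rfl) <;> assumption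
    · intro t ht
      exact ⟨F t, hF t (mem_filter.1 ht).1, (mem_filter.1 ht).2⟩
  have s12 : ∀ p ∈ S, ∀ q ∈ S, #{t ∈ T | F t p = q} < 3 := by
    intro p hp q hq
    by_cases h : p = q
    · subst h; exact s1 p hp
    · exact s2 p hp q hq h
  have hmix : ∀ a b, Mixed i (comb ψ φ a b) := by
    have hc : 3 ≤ #{t ∈ T | ¬ F t i = i} := by
      have := card_filter_add_card_filter_not (s := T) (fun t => F t i = i)
      have := s1 i hi
      omega
    refine mixed_lift i (T := {t ∈ T | ¬ F t i = i}) ?_ hc ψ φ ?_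
    · exact fun s hs t ht => hNP s (mem_filter.1 hs).1 t (mem_filter.1 ht).1
    · intro t ht
      exact pair_mixed (hF t (mem_filter.1 ht).1) hi (mem_filter.1 ht).2
  have mψ : Mixed i ψ := by
    have := hmix 1 0
    rwa [show comb ψ φ 1 0 = ψ from funext fun s => by simp [comb]] at this
  have mφ : Mixed i φ := by
    have := hmix 0 1
    rwa [show comb ψ φ 0 1 = φ from funext fun s => by simp [comb]] at this
  obtain ⟨f, hf⟩ := hψ
  obtain ⟨g, hg⟩ := hφ
  have hfi : f i ≠ i := fun h => not_mixed hf hi h mψ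
  have hgi : g i ≠ i := fun h => not_mixed hg hi h mφ
  have hk := hf.2.2.1 i hi
  have hl := hg.2.2.1 i hi
  obtain ⟨Φ, ψ', -, hψ', rfl⟩ := hf.peel2 hi hfi
  obtain ⟨Φ', φ', -, hφ', rfl⟩ := hg.peel2 hi hgi
  generalize f i = k at *
  generalize g i = l at *
  obtain ⟨t, ht, ht'⟩ : ∃ t ∈ T, t ∉ ({t ∈ T | F t i = i} ∪ {t ∈ T | F t k = k} ∪
      {t ∈ T | F t l = l} ∪ {t ∈ T | F t i = k} ∪ {t ∈ T | F t i = l} ∪ {t ∈ T | F t k = l} :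
        Finset (ℝ × ℝ)) := by
    apply exists_mem_notMem_of_card_lt_card
    have c1 := s12 i hi i hi
    have c2 := s12 k hk k hk
    have c3 := s12 l hl l hl
    have c4 := s12 i hi k hk
    have c5 := s12 i hi l hl
    have c6 := s12 k hk l hl
    refine lt_of_le_of_lt ((card_union_le _ _).trans (add_le_add_left ((card_union_le _ _).trans
      (add_le_add_left ((card_union_le _ _).trans (add_le_add_left ((card_union_le _ _).trans
      (add_le_add_left (card_union_le _ _) _)) _)) _)) _)) ?_
    omega
  simp only [mem_union, mem_filter, ht, true_and, not_or] at ht'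
  obtain ⟨⟨⟨⟨⟨t1, t2⟩, t3⟩, t4⟩, t5⟩, t6⟩ := ht'
  by_cases hkl : k = l
  · subst hkl
    exact rank2 hfi.symm hψ'.dep hφ'.dep (by simp) (by simp) (by simp) (by simp) (hF t ht) hi hk
      t1 t2 t4
  · exact rank3 hfi.symm hgi.symm hkl hψ'.dep hφ'.dep (by simp) (by simp) (by simp) (by simp)
      (hF t ht) hi hk hl t1 t2 t3 t4 t5 t6

/-- The 21 Lemma: if `ψ` and `φ` are `n`-qubit states of product form `𝒫ₙ` and
`τ a = a • ψ + √(1-a²) • φ` is of product form for 21 pairwise distinct values of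
`a ∈ [0,1]`, then `τ a` is of product form for every `a ∈ [0,1]` with `τ a ≠ 0`. -/
theorem twentyOne {n : ℕ} (ψ φ : (Fin n → Fin 2) → ℂ)
    (hψ : ∑ s : Fin n → Fin 2, ‖ψ s‖ ^ 2 = 1)
    (hφ : ∑ s : Fin n → Fin 2, ‖φ s‖ ^ 2 = 1)
    (hψP : ProductForm ψ) (hφP : ProductForm φ)
    (A : Finset ℝ) (hcard : A.card = 21) (hA : ∀ a ∈ A, a ∈ Set.Icc (0 : ℝ) 1)
    (hAP : ∀ a ∈ A, ProductForm
      (fun s => (a : ℂ) * ψ s + ((Real.sqrt (1 - a ^ 2) : ℝ) : ℂ) * φ s)) :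
    ∀ a ∈ Set.Icc (0 : ℝ) 1,
      (fun s : Fin n → Fin 2 =>
        (a : ℂ) * ψ s + ((Real.sqrt (1 - a ^ 2) : ℝ) : ℂ) * φ s) ≠ 0 →
      ProductForm
        (fun s => (a : ℂ) * ψ s + ((Real.sqrt (1 - a ^ 2) : ℝ) : ℂ) * φ s) := by
  have hinj : Function.Injective (fun a : ℝ => (a, Real.sqrt (1 - a ^ 2))) :=
    fun x y h => congrArg Prod.fst h
  have hn : 0 < n := by
    rcases Nat.eq_zero_or_pos n with rfl | h
    · exfalso
      have one : ∀ v : (Fin 0 → Fin 2) → ℂ, ProductForm v → v 0 = 1 := by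
        rintro v ⟨-, f, -, x, y, -, -, h⟩
        simpa using h 0
      have hsub : A ⊆ {0, 1} := by
        intro a ha
        have h1 := one _ (hAP a ha)
        rw [one _ hψP, one _ hφP] at h1
        have h2 : a + Real.sqrt (1 - a ^ 2) = 1 := by
          simp only [mul_one] at h1
          exact_mod_cast h1
        have h3 := Real.sq_sqrt (show 0 ≤ 1 - a ^ 2 by nlinarith [(hA a ha).1, (hA a ha).2])
        rw [show Real.sqrt (1 - a ^ 2) = 1 - a by linarith] at h3
        have h4 : a * (a - 1) = 0 := by nlinarith
        rcases mul_eq_zero.1 h4 with h | h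
        · simp [h]
        · simp [sub_eq_zero.1 h]
      have := card_le_card hsub
      have h2 : #({0, 1} : Finset ℝ) ≤ 2 := card_le_two
      omega
    · exact h
  intro a _ hne
  refine productForm_of_PF hn (main_all univ ψ φ
    (A.map ⟨fun a : ℝ => (a, Real.sqrt (1 - a ^ 2)), hinj⟩)
    (PF_of_productForm hψP) (PF_of_productForm hφP) ?_ (by simp [hcard]) ?_ a
      (Real.sqrt (1 - a ^ 2)) hne)
  · intro s hs t ht hst h
    simp only [mem_map, Function.Embedding.coeFn_mk] at hs ht
    obtain ⟨x, hx, rfl⟩ := hs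
    obtain ⟨y, hy, rfl⟩ := ht
    apply hst
    have hx1 := Real.sq_sqrt (show 0 ≤ 1 - x ^ 2 by nlinarith [(hA x hx).1, (hA x hx).2])
    have hy1 := Real.sq_sqrt (show 0 ≤ 1 - y ^ 2 by nlinarith [(hA y hy).1, (hA y hy).2])
    have : x ^ 2 = y ^ 2 := by
      have h' : x * Real.sqrt (1 - y ^ 2) = Real.sqrt (1 - x ^ 2) * y := by linarith [h]
      have h2 := congrArg (· ^ 2) h'
      simp only [mul_pow, hx1, hy1] at h2
      linarith
    have hxy : x = y := (sq_eq_sq₀ (hA x hx).1 (hA y hy).1).1 this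
    rw [hxy]
  · intro t ht
    simp only [mem_map, Function.Embedding.coeFn_mk] at ht
    obtain ⟨x, hx, rfl⟩ := ht
    exact PF_of_productForm (hAP x hx)
end
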